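/- (Discrete Schnol theorem) Let V : ℤ^d → ℝ be bounded and E ∈ ℝ. If there exists a function u : ℤ^d → ℝ, not identically zero, which is polynomially bounded (|u(n)| ≤ C(1+|n|_1)^m for some C > 0 and m ∈ ℕ) and satisfies −∑_{m':|m'−n|_1=1} u(m') + V(n)u(n) = E u(n) for all n ∈ ℤ^d, then E ∈ σ(h_0 + V). -/

import Mathlib

open scoped BigOperators

noncomputable section

/-- Points of the lattice `ℤ^d`. -/
abbrev Zd (d : ℕ) := Fin d → ℤ

/-- 1-norm distance on `ℤ^d`. -/
def dist1 {d : ℕ} (x y : Zd d) : ℤ := ∑ i, |x i - y i|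

/-- The set of nearest neighbors of a point of `ℤ^d`. -/
def nbhd {d : ℕ} (n : Zd d) : Finset (Zd d) :=
  (Fintype.piFinset fun i => Finset.Icc (n i - 1) (n i + 1)).filter fun m => dist1 n m = 1

/-- `ℓ²(ℤ^d)` with real coefficients. -/
abbrev l2 (d : ℕ) := lp (fun _ : Zd d => ℝ) 2

/-- A product of summable nonnegative functions of the coordinates is summable on `ℤ^d`. -/
theorem summable_prod_coord {d : ℕ} {f : ℤ → ℝ} (hf0 : ∀ k, 0 ≤ f k) (hf : Summable f) :
    Summable fun n : Zd d => ∏ i, f (n i) := by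
  refine summable_of_sum_le (c := ∏ _i : Fin d, ∑' k, f k)
    (fun n => Finset.prod_nonneg fun i _ => hf0 _) fun s => ?_
  calc ∑ n ∈ s, ∏ i, f (n i)
      ≤ ∑ n ∈ Fintype.piFinset fun i => s.image fun n => n i, ∏ i, f (n i) := by
        refine Finset.sum_le_sum_of_subset_of_nonneg (fun n hn => ?_)
          fun n _ _ => Finset.prod_nonneg fun i _ => hf0 _
        exact Fintype.mem_piFinset.2 fun i => Finset.mem_image_of_mem _ hn
    _ = ∏ i, ∑ k ∈ s.image fun n => n i, f k := by rw [Finset.prod_univ_sum]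
    _ ≤ ∏ _i : Fin d, ∑' k, f k :=
        Finset.prod_le_prod (fun i _ => Finset.sum_nonneg fun k _ => hf0 k)
          fun i _ => hf.sum_le_tsum _ fun k _ => hf0 k

/-- The 1-norm on `ℤ^d`, as a natural number. -/
def norm1 {d : ℕ} (n : Zd d) : ℕ := ∑ i, (n i).natAbs

theorem norm1_cast {d : ℕ} (n : Zd d) : (norm1 n : ℤ) = dist1 n 0 := by
  simp [norm1, dist1]

theorem dist1_comm {d : ℕ} (x y : Zd d) : dist1 x y = dist1 y x := by
  simp only [dist1, abs_sub_comm]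

theorem norm1_le_add_dist1 {d : ℕ} (x y : Zd d) : (norm1 x : ℤ) ≤ norm1 y + dist1 x y := by
  rw [norm1_cast, norm1_cast, dist1, dist1, dist1, ← Finset.sum_add_distrib]
  refine Finset.sum_le_sum fun i _ => ?_
  have := abs_add_le (y i) (x i - y i)
  simpa using this

theorem norm1_of_mem_nbhd {d : ℕ} {n j : Zd d} (h : j ∈ nbhd n) :
    norm1 n ≤ norm1 j + 1 ∧ norm1 j ≤ norm1 n + 1 := by
  have h1 : dist1 n j = 1 := (Finset.mem_filter.1 h).2
  have h2 := norm1_le_add_dist1 n j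
  have h3 := norm1_le_add_dist1 j n
  rw [dist1_comm j n] at h3
  omega

theorem summable_pow_norm1 {d : ℕ} {r : ℝ} (hr0 : 0 ≤ r) (hr1 : r < 1) :
    Summable fun n : Zd d => r ^ norm1 n := by
  have h := summable_geometric_of_lt_one hr0 hr1
  have h1 : Summable fun k : ℤ => r ^ k.natAbs :=
    Summable.of_nat_of_neg (by simpa using h) (by simpa using h)
  have h2 := summable_prod_coord (d := d) (fun k => pow_nonneg hr0 k.natAbs) h1
  simpa only [norm1, Finset.prod_pow_eq_pow_sum] using h2

theorem exists_succ_pow_mul_pow_le {r : ℝ} (hr0 : 0 < r) (hr1 : r < 1) (m : ℕ) :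
    ∃ C : ℝ, ∀ k : ℕ, (1 + (k : ℝ)) ^ m * r ^ k ≤ C := by
  have h := tendsto_pow_const_mul_const_pow_of_abs_lt_one m
    (show |r| < 1 by rwa [abs_of_pos hr0])
  obtain ⟨B, hB⟩ := h.bddAbove_range
  refine ⟨B / r, fun k => ?_⟩
  rw [le_div_iff₀ hr0]
  have := hB ⟨k + 1, rfl⟩
  push_cast at this
  calc (1 + (k : ℝ)) ^ m * r ^ k * r = ((k : ℝ) + 1) ^ m * r ^ (k + 1) := by ring
    _ ≤ B := this

/-- An exponential weight makes a polynomially bounded function square summable. -/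
theorem memℓp_weight_mul {d : ℕ} {r : ℝ} (hr0 : 0 < r) (hr1 : r < 1) {u : Zd d → ℝ} {C : ℝ}
    {m : ℕ} (hu : ∀ n, |u n| ≤ C * (1 + (norm1 n : ℝ)) ^ m) :
    Memℓp (fun n : Zd d => r ^ norm1 n * u n) 2 := by
  obtain ⟨B, hB⟩ := exists_succ_pow_mul_pow_le hr0 hr1 (2 * m)
  rw [memℓp_gen_iff (by norm_num)]
  refine Summable.of_nonneg_of_le (fun n => by positivity) (fun n => ?_)
    ((summable_pow_norm1 hr0.le hr1).mul_left (C ^ 2 * B))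
  have h1 : u n ^ 2 ≤ (C * (1 + (norm1 n : ℝ)) ^ m) ^ 2 := by
    rw [← sq_abs]
    exact pow_le_pow_left₀ (abs_nonneg _) (hu n) 2
  have h2 : (0 : ℝ) < r ^ norm1 n := by positivity
  calc ‖r ^ norm1 n * u n‖ ^ (2 : ENNReal).toReal = (r ^ norm1 n) ^ 2 * u n ^ 2 := by
        simp [mul_pow, abs_of_pos hr0]
    _ ≤ (r ^ norm1 n) ^ 2 * (C * (1 + (norm1 n : ℝ)) ^ m) ^ 2 := by gcongr
    _ = C ^ 2 * ((1 + (norm1 n : ℝ)) ^ (2 * m) * r ^ norm1 n) * r ^ norm1 n := by ring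
    _ ≤ C ^ 2 * B * r ^ norm1 n := by
        gcongr
        exact hB _

theorem abs_inv_pow_sub_inv_pow_le {δ : ℝ} (hδ : 0 < δ) {a b : ℕ} (h1 : a ≤ b + 1) (h2 : b ≤ a + 1) :
    |((1 + δ)⁻¹) ^ a - ((1 + δ)⁻¹) ^ b| ≤ δ * ((1 + δ)⁻¹) ^ a := by
  set r := (1 + δ)⁻¹ with hr
  have hr0 : 0 < r := by positivity
  have hrδ : r * (1 + δ) = 1 := inv_mul_cancel₀ (by positivity)
  have hr1 : r ≤ 1 := by nlinarith
  obtain h | h | h : b = a ∨ b = a + 1 ∨ a = b + 1 := by omega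
  · subst h
    simp only [sub_self, abs_zero]
    positivity
  · subst h
    have hp : 0 < r ^ a := by positivity
    rw [show r ^ a - r ^ (a + 1) = r ^ a * (1 - r) by ring,
      abs_of_nonneg (mul_nonneg hp.le (by linarith))]
    rw [mul_comm]
    exact mul_le_mul_of_nonneg_right (by nlinarith) hp.le
  · subst h
    have hp : 0 < r ^ b := by positivity
    rw [show r ^ (b + 1) - r ^ b = -(r ^ b * (1 - r)) by ring, abs_neg,
      abs_of_nonneg (mul_nonneg hp.le (by linarith))]
    exact le_of_eq (by linear_combination (-r ^ b) * hrδ)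

/-- The pointwise absolute value of a square summable function. -/
def l2Abs {d : ℕ} (f : l2 d) : l2 d :=
  ⟨fun n => |f n|, (lp.memℓp f).norm⟩

theorem l2Abs_apply {d : ℕ} (f : l2 d) (n : Zd d) : l2Abs f n = |f n| := rfl

theorem norm_l2Abs {d : ℕ} (f : l2 d) : ‖l2Abs f‖ = ‖f‖ :=
  le_antisymm (lp.norm_mono two_ne_zero fun n => by simp [l2Abs_apply])
    (lp.norm_mono two_ne_zero fun n => by simp [l2Abs_apply])

/-- If `w` is a weight times a solution of the eigenvalue equation and the weight varies by a
relative amount at most `δ` between neighbors, then `w` is an approximate eigenvector. -/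
theorem norm_sub_le_of_weight {d : ℕ} {V : Zd d → ℝ} {C E δ : ℝ} (hV : ∀ n, |V n| ≤ C)
    {H : l2 d →L[ℝ] l2 d}
    (hH : ∀ (u : l2 d) (n : Zd d), (H u) n = (-∑ j ∈ nbhd n, u j) + V n * u n)
    {u φ : Zd d → ℝ} (hueq : ∀ n, (-∑ j ∈ nbhd n, u j) + V n * u n = E * u n)
    (hδ : 0 ≤ δ) (hφ : ∀ n, ∀ j ∈ nbhd n, |φ j - φ n| ≤ δ * |φ j|)
    {w : l2 d} (hw : ∀ n, w n = φ n * u n) :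
    ‖E • w - H w‖ ≤ δ * (‖H‖ + C) * ‖w‖ := by
  have hC : 0 ≤ C := (abs_nonneg _).trans (hV 0)
  have key : ∀ n, ‖(E • w - H w) n‖ ≤ ‖(δ • (l2Abs (H (l2Abs w)) + C • l2Abs w)) n‖ := by
    intro n
    have e1 : (E • w - H w) n = ∑ j ∈ nbhd n, (φ j - φ n) * u j := by
      simp only [lp.coeFn_sub, lp.coeFn_smul, Pi.sub_apply, Pi.smul_apply, smul_eq_mul, hH, hw,
        sub_mul, Finset.sum_sub_distrib, ← Finset.mul_sum]
      linear_combination (-φ n) * hueq n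
    have e2 : ∑ j ∈ nbhd n, |w j| = -(H (l2Abs w)) n + V n * |w n| := by
      rw [hH]
      simp only [l2Abs_apply]
      ring
    have e3 : (δ • (l2Abs (H (l2Abs w)) + C • l2Abs w)) n
        = δ * (|(H (l2Abs w)) n| + C * |w n|) := rfl
    rw [e1, e3, Real.norm_eq_abs, Real.norm_eq_abs]
    calc |∑ j ∈ nbhd n, (φ j - φ n) * u j| ≤ ∑ j ∈ nbhd n, |(φ j - φ n) * u j| :=
          Finset.abs_sum_le_sum_abs _ _
      _ ≤ ∑ j ∈ nbhd n, δ * |w j| := by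
          refine Finset.sum_le_sum fun j hj => ?_
          rw [hw, abs_mul, abs_mul, ← mul_assoc]
          exact mul_le_mul_of_nonneg_right (hφ n j hj) (abs_nonneg _)
      _ = δ * (-(H (l2Abs w)) n + V n * |w n|) := by rw [← Finset.mul_sum, e2]
      _ ≤ δ * (|(H (l2Abs w)) n| + C * |w n|) := by
          gcongr
          · exact neg_le_abs _
          · exact (le_abs_self _).trans (hV n)
      _ ≤ _ := le_abs_self _
  calc ‖E • w - H w‖ ≤ ‖δ • (l2Abs (H (l2Abs w)) + C • l2Abs w)‖ := lp.norm_mono two_ne_zero key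
    _ ≤ δ * (‖l2Abs (H (l2Abs w))‖ + ‖C • l2Abs w‖) := by
        rw [norm_smul, Real.norm_of_nonneg hδ]
        gcongr
        exact norm_add_le _ _
    _ ≤ δ * (‖H‖ * ‖w‖ + C * ‖w‖) := by
        rw [norm_l2Abs, norm_smul, Real.norm_of_nonneg hC, norm_l2Abs]
        gcongr
        exact (H.le_opNorm _).trans_eq (by rw [norm_l2Abs])
    _ = δ * (‖H‖ + C) * ‖w‖ := by ring

/-- **Discrete Schnol theorem.**  Let `V : ℤ^d → ℝ` be bounded and let `h₀ + V` be the
corresponding bounded self-adjoint operator on `ℓ²(ℤ^d)`.  If there exists a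
non-trivial, polynomially bounded `u` satisfying the difference equation
`-∑_{|m'-n|₁=1} u(m') + V(n)u(n) = E u(n)` for all `n`, then `E ∈ σ(h₀ + V)`. -/
theorem discrete_schnol
    (d : ℕ) (hd : 1 ≤ d)
    (V : Zd d → ℝ) (hV : ∃ C : ℝ, ∀ n, |V n| ≤ C)
    (E : ℝ)
    (H : l2 d →L[ℝ] l2 d)
    (hH : ∀ (u : l2 d) (n : Zd d),
      (H u) n = (-∑ j ∈ nbhd n, u j) + V n * u n)
    (u : Zd d → ℝ)
    (hune : u ≠ 0)
    (hubnd : ∃ C > (0 : ℝ), ∃ m : ℕ, ∀ n,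
      |u n| ≤ C * (1 + ((dist1 n 0 : ℤ) : ℝ)) ^ m)
    (hueq : ∀ n, (-∑ j ∈ nbhd n, u j) + V n * u n = E * u n) :
    E ∈ spectrum ℝ H := by
  by_contra hE
  obtain ⟨C, hC⟩ := hV
  obtain ⟨B, -, m, hB⟩ := hubnd
  obtain ⟨n₀, hn₀⟩ := Function.ne_iff.1 hune
  have hC0 : 0 ≤ C := (abs_nonneg _).trans (hC 0)
  obtain ⟨T, hT⟩ := (spectrum.notMem_iff.1 hE).exists_left_inv
  set K := ‖T‖ * (‖H‖ + C) with hK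
  have hK0 : 0 ≤ K := by positivity
  set δ := (K + 1)⁻¹ with hδ
  have hδ0 : 0 < δ := by positivity
  have hr0 : 0 < (1 + δ)⁻¹ := by positivity
  have hr1 : (1 + δ)⁻¹ < 1 := inv_lt_one_of_one_lt₀ (by linarith)
  have hB' : ∀ n, |u n| ≤ B * (1 + (norm1 n : ℝ)) ^ m := fun n => by
    have := hB n
    rwa [← norm1_cast, Int.cast_natCast] at this
  let w : l2 d := ⟨fun n => ((1 + δ)⁻¹) ^ norm1 n * u n, memℓp_weight_mul hr0 hr1 hB'⟩
  have hw : ∀ n, w n = ((1 + δ)⁻¹) ^ norm1 n * u n := fun n => rfl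
  have hw0 : 0 < ‖w‖ := by
    refine norm_pos_iff.2 fun h => ?_
    have h1 : w n₀ = 0 := by rw [h]; rfl
    rw [hw] at h1
    exact mul_ne_zero (pow_pos hr0 _).ne' hn₀ h1
  have hle := norm_sub_le_of_weight hC hH hueq hδ0.le (fun n j hj => by
    rw [abs_of_pos (pow_pos hr0 (norm1 j))]
    exact abs_inv_pow_sub_inv_pow_le hδ0 (norm1_of_mem_nbhd hj).2 (norm1_of_mem_nbhd hj).1) hw
  have hTw : T (E • w - H w) = w := by
    have := DFunLike.congr_fun hT w
    simpa [Algebra.algebraMap_eq_smul_one] using this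
  have h1 : ‖w‖ ≤ δ * K * ‖w‖ :=
    calc ‖w‖ = ‖T (E • w - H w)‖ := by rw [hTw]
      _ ≤ ‖T‖ * (δ * (‖H‖ + C) * ‖w‖) := (T.le_opNorm _).trans (by gcongr)
      _ = δ * K * ‖w‖ := by rw [hK]; ring
  have h2 : δ * (K + 1) = 1 := inv_mul_cancel₀ (by positivity)
  have h3 : 1 ≤ δ * K := by
    by_contra! h
    nlinarith
  linarith
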